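/- arXiv:2406.03089 — 2 statements merged into one kernel-verified Lean document; each statement's English description precedes it below -/
import Mathlib

section
/- The unscented transform is exact in variance for affine objective functions: for any a ∈ ℝⁿ and b ∈ ℝ, the weighted variance of the transformed sigma points satisfies Σ_{j=0}^{2n} wⱼ (aᵀ𝒳ʲ + b − (aᵀx + b))² = aᵀ P a. -/
open Matrix Finset

/-- The quadratic form of the Gram matrix `Lᵀ * L` is the sum of the squared products with
the rows of `L`. -/
theorem sum_sq_dotProduct_row {m n R : Type*} [Fintype m] [Fintype n] [CommRing R]
    (L : Matrix m n R) (a : n → R) :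
    ∑ j, (a ⬝ᵥ L j) ^ 2 = a ⬝ᵥ (Lᵀ * L) *ᵥ a := by
  rw [← mulVec_mulVec, dotProduct_mulVec, vecMul_transpose]
  refine Finset.sum_congr rfl fun j _ => ?_
  rw [sq, dotProduct_comm a]
  rfl

/-- The unscented transform is exact in variance for affine objective functions:
for any `a ∈ ℝⁿ` and `b ∈ ℝ`, `Σ_{j=0}^{2n} wⱼ (aᵀ𝒳ʲ + b − (aᵀx + b))² = aᵀ P a`,
where `𝒳⁰ = x`, `𝒳ʲ = x + Lⱼ`, `𝒳^{j+n} = x − Lⱼ` (`Lⱼ` the `j`-th row of `L`),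
`w₀ = λ/(n+λ)`, `wⱼ = 1/(2(n+λ))` for `j ≥ 1`, with `Lᵀ L = (n+λ) P` for a
symmetric positive definite `P` and `n + λ > 0`. -/
theorem ut_exact_variance_affine
    (n : ℕ) (x : Fin n → ℝ) (l : ℝ) (hl : (n : ℝ) + l > 0)
    (P L : Matrix (Fin n) (Fin n) ℝ) (hP : P.PosDef)
    (hL : Lᵀ * L = (((n : ℝ) + l) • P))
    (a : Fin n → ℝ) (b : ℝ) :
    (l / ((n : ℝ) + l)) * (a ⬝ᵥ x + b - (a ⬝ᵥ x + b)) ^ 2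
      + (∑ j : Fin n, (1 / (2 * ((n : ℝ) + l))) * (a ⬝ᵥ (x + L j) + b - (a ⬝ᵥ x + b)) ^ 2)
      + (∑ j : Fin n, (1 / (2 * ((n : ℝ) + l))) * (a ⬝ᵥ (x - L j) + b - (a ⬝ᵥ x + b)) ^ 2)
      = a ⬝ᵥ P.mulVec a := by
  have hne : (n : ℝ) + l ≠ 0 := hl.ne'
  have hplus (j : Fin n) : a ⬝ᵥ (x + L j) + b - (a ⬝ᵥ x + b) = a ⬝ᵥ L j := by
    rw [dotProduct_add]; ring
  have hminus (j : Fin n) : a ⬝ᵥ (x - L j) + b - (a ⬝ᵥ x + b) = -(a ⬝ᵥ L j) := by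
    rw [dotProduct_sub]; ring
  simp only [hplus, hminus, neg_sq, ← Finset.mul_sum]
  rw [sum_sq_dotProduct_row, hL, smul_mulVec, dotProduct_smul, smul_eq_mul]
  field_simp
  ring
end

section
/- The unscented transform is exact in mean for quadratic objective functions: for any A ∈ ℝ^{n×n}, b ∈ ℝⁿ and c ∈ ℝ, the weighted mean of the transformed sigma points satisfies Σ_{j=0}^{2n} wⱼ ((𝒳ʲ)ᵀ A 𝒳ʲ + bᵀ𝒳ʲ + c) = xᵀ A x + bᵀ x + c + trace(A P). -/
open Matrix Finset

/-- The trace of `A * (Lᵀ * L)` is the sum of the quadratic form of `A` over the rows of `L`. -/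
theorem trace_mul_transpose_mul_self {m n R : Type*} [Fintype m] [Fintype n] [CommSemiring R]
    (A : Matrix n n R) (L : Matrix m n R) :
    (A * (Lᵀ * L)).trace = ∑ j, L j ⬝ᵥ A.mulVec (L j) := by
  rw [← Matrix.mul_assoc, Matrix.trace_mul_comm]
  rfl

/-- The sum of the values of a quadratic function at two points symmetric about `x`. -/
theorem quadratic_add_add_quadratic_sub {n R : Type*} [Fintype n] [CommRing R]
    (A : Matrix n n R) (b x v : n → R) (c : R) :
    ((x + v) ⬝ᵥ A.mulVec (x + v) + b ⬝ᵥ (x + v) + c)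
      + ((x - v) ⬝ᵥ A.mulVec (x - v) + b ⬝ᵥ (x - v) + c)
      = 2 * (x ⬝ᵥ A.mulVec x + b ⬝ᵥ x + c) + 2 * (v ⬝ᵥ A.mulVec v) := by
  simp only [mulVec_add, mulVec_sub, dotProduct_add, dotProduct_sub, add_dotProduct,
    sub_dotProduct]
  ring

/-- The unscented transform is exact in mean for quadratic objective functions:
for any `A ∈ ℝ^{n×n}`, `b ∈ ℝⁿ`, `c ∈ ℝ`,
`Σ_{j=0}^{2n} wⱼ ((𝒳ʲ)ᵀ A 𝒳ʲ + bᵀ𝒳ʲ + c) = xᵀ A x + bᵀ x + c + trace(A P)`,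
where `𝒳⁰ = x`, `𝒳ʲ = x + Lⱼ`, `𝒳^{j+n} = x − Lⱼ` (`Lⱼ` the `j`-th row of `L`),
`w₀ = λ/(n+λ)`, `wⱼ = 1/(2(n+λ))` for `j ≥ 1`, with `Lᵀ L = (n+λ) P` for a
symmetric positive definite `P` and `n + λ > 0`. -/
theorem ut_exact_mean_quadratic
    (n : ℕ) (x : Fin n → ℝ) (l : ℝ) (hl : (n : ℝ) + l > 0)
    (P L : Matrix (Fin n) (Fin n) ℝ) (hP : P.PosDef)
    (hL : Lᵀ * L = (((n : ℝ) + l) • P))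
    (A : Matrix (Fin n) (Fin n) ℝ) (b : Fin n → ℝ) (c : ℝ) :
    (l / ((n : ℝ) + l)) * (x ⬝ᵥ A.mulVec x + b ⬝ᵥ x + c)
      + (∑ j : Fin n, (1 / (2 * ((n : ℝ) + l))) *
          ((x + L j) ⬝ᵥ A.mulVec (x + L j) + b ⬝ᵥ (x + L j) + c))
      + (∑ j : Fin n, (1 / (2 * ((n : ℝ) + l))) *
          ((x - L j) ⬝ᵥ A.mulVec (x - L j) + b ⬝ᵥ (x - L j) + c))
      = x ⬝ᵥ A.mulVec x + b ⬝ᵥ x + c + (A * P).trace := by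
  have hne : (n : ℝ) + l ≠ 0 := hl.ne'
  have htr : ∑ j, L j ⬝ᵥ A.mulVec (L j) = ((n : ℝ) + l) * (A * P).trace := by
    rw [← trace_mul_transpose_mul_self, hL, Matrix.mul_smul, trace_smul, smul_eq_mul]
  rw [add_assoc, ← sum_add_distrib]
  simp only [← mul_add, quadratic_add_add_quadratic_sub]
  rw [← mul_sum, ← mul_sum, sum_add_distrib, htr, sum_const, card_univ,
    Fintype.card_fin, nsmul_eq_mul]
  field_simp
  ring
end
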